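/- In S(F₃;ℂ), with γ = g₂g₁⁻¹g₃g₁g₃⁻¹ and δ = g₁⁻¹g₃g₁g₃⁻¹g₂, one has Φ(Q) = [γg₁g₂g₃] − [δg₁g₂g₃], where Q = (−x₁x₂₃ + x₃x₁₂)x₁₃x₁₂₃ + (x₁x₁₂ − x₃x₂₃)x₁₂₃ + (x₃² − x₁²)x₁₂x₂₃ + (x₂₃² − x₁₂²)x₁₃ + (x₁²x₃x₂₃ − x₁x₃²x₁₂)x₁₂₃ + (x₁₂² − x₂₃²)x₁x₃ + (x₁x₂₃ − x₃x₁₂)x₂. -/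

import Mathlib

open MvPolynomial

noncomputable section

def skeinIdeal (R G : Type*) [CommRing R] [Group G] : Ideal (MvPolynomial G R) :=
  Ideal.span ({X (1 : G) - 2} ∪
    {p | ∃ g h : G, p = X g * X h - X (g * h) - X (g * h⁻¹)})

abbrev SkeinAlgebra (R G : Type*) [CommRing R] [Group G] :=
  MvPolynomial G R ⧸ skeinIdeal R G

def cl (R : Type*) {G : Type*} [CommRing R] [Group G] (g : G) : SkeinAlgebra R G :=
  Ideal.Quotient.mk (skeinIdeal R G) (X g)

/-- The free group on three generators. -/
abbrev F3 := FreeGroup (Fin 3)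

def g1 : F3 := FreeGroup.of 0
def g2 : F3 := FreeGroup.of 1
def g3 : F3 := FreeGroup.of 2

/-- The words `g₁, g₂, g₃, g₁g₂, g₁g₃, g₂g₃, g₁g₂g₃` indexed by the seven variables
`x₁, x₂, x₃, x₁₂, x₁₃, x₂₃, x₁₂₃`. -/
def word : Fin 7 → F3 := ![g1, g2, g3, g1 * g2, g1 * g3, g2 * g3, g1 * g2 * g3]

/-- `Φ : ℂ[x₁,…,x₁₂₃] → S(F₃;ℂ)`, `x_{i₁⋯i_k} ↦ [g_{i₁}⋯g_{i_k}]`. -/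
def Phi : MvPolynomial (Fin 7) ℂ →ₐ[ℂ] SkeinAlgebra ℂ F3 :=
  aeval fun i => cl ℂ (word i)

-- the seven variables
def x1 : MvPolynomial (Fin 7) ℂ := X 0
def x2 : MvPolynomial (Fin 7) ℂ := X 1
def x3 : MvPolynomial (Fin 7) ℂ := X 2
def x12 : MvPolynomial (Fin 7) ℂ := X 3
def x13 : MvPolynomial (Fin 7) ℂ := X 4
def x23 : MvPolynomial (Fin 7) ℂ := X 5
def x123 : MvPolynomial (Fin 7) ℂ := X 6

/-- The polynomial `K`. -/
def K : MvPolynomial (Fin 7) ℂ :=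
  x123 ^ 2 - (x12 * x3 + x13 * x2 + x23 * x1 - x1 * x2 * x3) * x123
    + x1 ^ 2 + x2 ^ 2 + x3 ^ 2 + x12 ^ 2 + x23 ^ 2 + x13 ^ 2
    - x1 * x2 * x12 - x1 * x3 * x13 - x2 * x3 * x23 + x12 * x13 * x23 - 4

def rgamma : F3 := g2 * g1⁻¹ * g3 * g1 * g3⁻¹
def rdelta : F3 := g1⁻¹ * g3 * g1 * g3⁻¹ * g2

def Q : MvPolynomial (Fin 7) ℂ :=
  (-(x1*x23) + x3*x12)*x13*x123 + (x1*x12 - x3*x23)*x123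
    + (x3^2 - x1^2)*x12*x23 + (x23^2 - x12^2)*x13
    + (x1^2*x3*x23 - x1*x3^2*x12)*x123 + (x12^2 - x23^2)*x1*x3
    + (x1*x23 - x3*x12)*x2

section SkeinRelations

variable {R G : Type*} [CommRing R] [Group G]

theorem cl_one : cl R (1 : G) = 2 := by
  have h : Ideal.Quotient.mk (skeinIdeal R G) (X 1 - 2) = 0 :=
    Ideal.Quotient.eq_zero_iff_mem.2 (Ideal.subset_span (Or.inl rfl))
  rwa [map_sub, map_ofNat, sub_eq_zero] at h

theorem cl_mul_cl (g h : G) : cl R g * cl R h = cl R (g * h) + cl R (g * h⁻¹) := by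
  have H : Ideal.Quotient.mk (skeinIdeal R G) (X g * X h - X (g * h) - X (g * h⁻¹)) = 0 :=
    Ideal.Quotient.eq_zero_iff_mem.2 (Ideal.subset_span (Or.inr ⟨g, h, rfl⟩))
  simp only [map_sub, map_mul] at H
  unfold cl
  linear_combination H

theorem cl_inv (g : G) : cl R g⁻¹ = cl R g := by
  have h := cl_mul_cl (R := R) 1 g
  rw [cl_one, one_mul, one_mul] at h
  linear_combination -h

theorem cl_mul_comm (g h : G) : cl R (g * h) = cl R (h * g) := by
  have h₁ := cl_mul_cl (R := R) g h
  have h₂ := cl_mul_cl (R := R) h g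
  have h₃ := cl_inv (R := R) (g * h⁻¹)
  rw [mul_inv_rev, inv_inv] at h₃
  linear_combination h₂ - h₁ + h₃

theorem cl_mul_inv (x g : G) : cl R (x * g⁻¹) = cl R g * cl R x - cl R (x * g) := by
  linear_combination -cl_mul_cl (R := R) x g

theorem cl_mul_inv_mul (x g y : G) :
    cl R (x * g⁻¹ * y) = cl R g * cl R (x * y) - cl R (x * g * y) := by
  rw [cl_mul_comm _ y, cl_mul_comm _ y, cl_mul_comm _ y, ← mul_assoc, ← mul_assoc, cl_mul_inv]

theorem cl_mul_mul_self (x g : G) : cl R (x * g * g) = cl R g * cl R (x * g) - cl R x := by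
  have h := cl_mul_cl (R := R) (x * g) g
  rw [mul_inv_cancel_right] at h
  linear_combination -h

/-- Skein form of the Cayley–Hamilton identity `g * h * g = tr (g * h) • g - h⁻¹`. -/
theorem cl_mul_mul_mul_self (x g h : G) :
    cl R (x * g * h * g) = cl R (g * h) * cl R (x * g) - cl R (x * h⁻¹) := by
  have H := cl_mul_cl (R := R) (x * g) (h * g)
  rw [mul_inv_rev, ← mul_assoc, ← mul_assoc, mul_inv_cancel_right, cl_mul_comm h g] at H
  linear_combination -H

theorem cl_mul_mul_swap (a b c : G) :
    cl R (a * c * b) = cl R a * cl R (b * c) + cl R b * cl R (a * c) + cl R c * cl R (a * b)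
      - cl R a * cl R b * cl R c - cl R (a * b * c) := by
  have h₁ := cl_mul_cl (R := R) a (b * c)
  rw [mul_inv_rev, ← mul_assoc, ← mul_assoc, cl_mul_inv, cl_mul_inv, cl_mul_inv_mul] at h₁
  linear_combination -h₁

theorem cl_commutator_word_sub (a b c : G) :
    cl R (b * a⁻¹ * c * a * c⁻¹ * a * b * c) - cl R (a⁻¹ * c * a * c⁻¹ * b * a * b * c) =
      cl R (b * c) * (cl R (a * c⁻¹) * cl R (b * a⁻¹ * c * a) - cl R (b * a⁻¹ * c * c))
      - cl R (a * b) * (cl R (a * c⁻¹) * cl R (a * c⁻¹ * b * c) - cl R (c⁻¹ * b * a * a)) := by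
  have hγ : cl R (b * a⁻¹ * c * a * c⁻¹ * a * b * c) =
      cl R (b * c) * cl R (b * a⁻¹ * c * a * c⁻¹ * a)
        - cl R (c⁻¹ * a⁻¹ * c * a * c⁻¹ * a) := by
    have h := cl_mul_mul_mul_self (R := R) (a⁻¹ * c * a * c⁻¹ * a) b c
    rw [cl_mul_comm _ b, cl_mul_comm _ b, cl_mul_comm _ c⁻¹] at h
    simpa only [mul_assoc] using h
  have hδ : cl R (a⁻¹ * c * a * c⁻¹ * b * a * b * c) =
      cl R (a * b) * cl R (a * c⁻¹ * b * c * a⁻¹ * c)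
        - cl R (a * c⁻¹ * a⁻¹ * c * a⁻¹ * c) := by
    have h := cl_mul_mul_mul_self (R := R) (c * a⁻¹ * c * a * c⁻¹) b a
    rw [cl_mul_comm b a] at h
    have h₁ := cl_mul_comm (R := R) (a⁻¹ * c * a * c⁻¹ * b * a * b) c
    have h₂ := cl_mul_comm (R := R) (c * a⁻¹ * c) (a * c⁻¹ * b)
    have h₃ := cl_mul_comm (R := R) (c * a⁻¹ * c) (a * c⁻¹ * a⁻¹)
    simp only [mul_assoc] at h h₁ h₂ h₃ ⊢
    rw [h₁, h, h₂, h₃]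
  have hca : cl R (c * a⁻¹) = cl R (a * c⁻¹) := by
    rw [← cl_inv, mul_inv_rev, inv_inv]
  have h₁ := cl_mul_mul_mul_self (R := R) (b * a⁻¹ * c) a c⁻¹
  have h₂ := cl_mul_mul_mul_self (R := R) (c⁻¹ * a⁻¹ * c) a c⁻¹
  have h₃ := cl_mul_mul_mul_self (R := R) (a * c⁻¹ * b) c a⁻¹
  have h₄ := cl_mul_mul_mul_self (R := R) (a * c⁻¹ * a⁻¹) c a⁻¹
  rw [inv_inv] at h₁ h₂ h₃ h₄
  rw [hca] at h₃ h₄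
  have h₅ : cl R (c⁻¹ * a⁻¹ * c * c) = cl R (a * c⁻¹) := by
    rw [cl_mul_comm, ← hca, ← cl_inv, cl_mul_comm c, ← cl_inv]
    congr 1
    group
  have h₆ : cl R (a * c⁻¹ * a⁻¹ * a) = cl R (a * c⁻¹) := by
    rw [inv_mul_cancel_right]
  have h₇ : cl R (a * c⁻¹ * a⁻¹ * c) = cl R (c⁻¹ * a⁻¹ * c * a) := by
    rw [cl_mul_comm _ a]
    simp only [mul_assoc]
  have h₈ : cl R (a * c⁻¹ * b * a) = cl R (c⁻¹ * b * a * a) := by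
    have h := cl_mul_comm (R := R) a (c⁻¹ * b * a)
    simpa only [mul_assoc] using h
  rw [hγ, hδ, h₁, h₂, h₃, h₄, h₅, h₆, h₇, h₈]
  ring

theorem cl_mul_inv_mul_mul (a b c : G) :
    cl R (b * a⁻¹ * c * a) = cl R a * cl R (a * b * c) - cl R (a * c) * cl R (a * b)
      + cl R b * cl R c - cl R (b * c) := by
  have h := cl_mul_inv_mul (R := R) b a (c * a)
  have h₁ := cl_mul_comm (R := R) (b * c) a
  simp only [← mul_assoc] at h h₁
  rw [h, cl_mul_mul_mul_self, h₁, cl_mul_inv, cl_mul_comm b a]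
  ring

theorem cl_mul_inv_mul_mul' (a b c : G) :
    cl R (a * c⁻¹ * b * c) = cl R c * cl R (a * b * c) - cl R (b * c) * cl R (a * c)
      + cl R a * cl R b - cl R (a * b) := by
  have h := cl_mul_inv_mul (R := R) a c (b * c)
  simp only [← mul_assoc] at h
  rw [h, cl_mul_mul_mul_self, cl_mul_inv, cl_mul_comm c b]
  ring

theorem cl_mul_inv_mul_sq (a b c : G) :
    cl R (b * a⁻¹ * c * c) = cl R c * (cl R a * cl R (b * c) - cl R (a * c * b))
      - (cl R a * cl R b - cl R (a * b)) := by
  rw [cl_mul_mul_self, cl_mul_inv_mul, cl_mul_inv, cl_mul_comm b a, mul_assoc b a c,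
    cl_mul_comm b (a * c)]

theorem cl_inv_mul_mul_sq (a b c : G) :
    cl R (c⁻¹ * b * a * a) = cl R a * (cl R c * cl R (a * b) - cl R (a * c * b))
      - (cl R c * cl R b - cl R (b * c)) := by
  have h := cl_mul_inv (R := R) (b * a) c
  have h₁ := cl_mul_comm (R := R) (b * a) c⁻¹
  have h₂ := cl_mul_comm (R := R) (a * c) b
  simp only [← mul_assoc] at h h₁ h₂
  rw [cl_mul_mul_self, ← h₁, h, h₂, cl_mul_comm b a, cl_mul_comm c⁻¹ b, cl_mul_inv]

end SkeinRelations

theorem phi_Q_gamma_g1g2g3 : Phi Q = cl ℂ (rgamma * g1 * g2 * g3) - cl ℂ (rdelta * g1 * g2 * g3) := by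
  have hδ : rdelta * g1 * g2 * g3 = g1⁻¹ * g3 * g1 * g3⁻¹ * g2 * g1 * g2 * g3 := rfl
  have hγ : rgamma * g1 * g2 * g3 = g2 * g1⁻¹ * g3 * g1 * g3⁻¹ * g1 * g2 * g3 := rfl
  have hΦ (i : Fin 7) : Phi (X i) = cl ℂ (word i) := aeval_X _ i
  rw [hγ, hδ, cl_commutator_word_sub, cl_mul_inv_mul_mul, cl_mul_inv_mul_mul',
    cl_mul_inv_mul_sq, cl_inv_mul_mul_sq, cl_mul_mul_swap g1 g2 g3, cl_mul_inv]
  simp only [Q, x1, x2, x3, x12, x13, x23, x123, map_add, map_sub, map_neg, map_mul, map_pow, hΦ]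
  have w1 : word 0 = g1 := rfl
  have w2 : word 1 = g2 := rfl
  have w3 : word 2 = g3 := rfl
  have w12 : word 3 = g1 * g2 := rfl
  have w13 : word 4 = g1 * g3 := rfl
  have w23 : word 5 = g2 * g3 := rfl
  have w123 : word 6 = g1 * g2 * g3 := rfl
  rw [w1, w2, w3, w12, w13, w23, w123]
  ring
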